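/- Let ν be a non-negative integrable measure on ℝⁿ. Then ν is universal on the space ℳ^int_unc(ℝⁿ) of integrable unconditional measures on ℝⁿ if and only if ν has degree n, i.e. ν_{[n]} ≠ 0. -/

import Mathlib

open MeasureTheory
open scoped ENNReal symmDiff Classical

noncomputable section

/-- The Euclidean (ℓ²) norm on `Fin n → ℝ`. -/
def e2 {n : ℕ} (x : Fin n → ℝ) : ℝ := Real.sqrt (∑ i, (x i) ^ 2)

/-- The unit sphere `S^{n-1}` in `ℝⁿ`. -/
def Sph (n : ℕ) : Set (Fin n → ℝ) := {x | e2 x = 1}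

/-- The set `A_E = {x : xᵢ ≠ 0 ↔ i ∈ E}`. -/
def setA {n : ℕ} (E : Finset (Fin n)) : Set (Fin n → ℝ) := {x | ∀ i, x i ≠ 0 ↔ i ∈ E}

/-- Finite signed Borel measures on `ℝⁿ`. -/
abbrev SM (n : ℕ) := MeasureTheory.SignedMeasure (Fin n → ℝ)

/-- A (finite) measure regarded as a signed measure (junk value `0` if not finite). -/
def toSigned {X : Type*} [MeasurableSpace X] (ρ : Measure X) : SignedMeasure X :=
  if h : IsFiniteMeasure ρ then @Measure.toSignedMeasure X _ ρ h else 0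

/-- Multiplicative convolution of two non-negative measures. -/
def mconvPos {n : ℕ} (ρ σ : Measure (Fin n → ℝ)) : Measure (Fin n → ℝ) :=
  (ρ.prod σ).map (fun p => p.1 * p.2)

/-- Multiplicative convolution `μ ⊛ ν` of two signed measures, via Jordan decomposition. -/
def mconv {n : ℕ} (μ ν : SM n) : SM n :=
  toSigned (mconvPos μ.toJordanDecomposition.posPart ν.toJordanDecomposition.posPart
      + mconvPos μ.toJordanDecomposition.negPart ν.toJordanDecomposition.negPart)
  - toSigned (mconvPos μ.toJordanDecomposition.posPart ν.toJordanDecomposition.negPart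
      + mconvPos μ.toJordanDecomposition.negPart ν.toJordanDecomposition.posPart)

/-- `μ` is integrable: `∫ ‖x‖₂ d|μ| < ∞`. -/
def IntegrableSM {n : ℕ} (μ : SM n) : Prop :=
  ∫⁻ x, ENNReal.ofReal (e2 x) ∂μ.totalVariation < ⊤

/-- `μ` is concentrated on `A`:  `|μ|(Aᶜ) = 0`. -/
def ConcOn {n : ℕ} (μ : SM n) (A : Set (Fin n → ℝ)) : Prop := μ.totalVariation Aᶜ = 0

/-- The multiple reflection `T_E` on `ℝⁿ`. -/
def flipE {n : ℕ} (E : Finset (Fin n)) (x : Fin n → ℝ) : Fin n → ℝ :=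
  fun i => if i ∈ E then -x i else x i

/-- Pushforward of a signed measure under `T_E`. -/
def Tmap {n : ℕ} (E : Finset (Fin n)) (μ : SM n) : SM n := μ.map (flipE E)

def EvenUnder {n : ℕ} (μ : SM n) (E : Finset (Fin n)) : Prop := Tmap E μ = μ
def OddUnder {n : ℕ} (μ : SM n) (E : Finset (Fin n)) : Prop := Tmap E μ = -μ

/-- Orthogonal projection onto the coordinate subspace `H_E`. -/
def projE {n : ℕ} (E : Finset (Fin n)) (x : Fin n → ℝ) : Fin n → ℝ :=
  fun i => if i ∈ E then x i else 0

/-- `P_E(μ)`: pushforward under `projE`. -/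
def Pmap {n : ℕ} (E : Finset (Fin n)) (μ : SM n) : SM n := μ.map (projE E)

/-- `R_E(μ) = μ_E`: restriction to `A_E`. -/
def Rres {n : ℕ} (E : Finset (Fin n)) (μ : SM n) : SM n := μ.restrict (setA E)

/-- Sign vector attached to `b : Fin n → Bool`. -/
def signVec {n : ℕ} (b : Fin n → Bool) : Fin n → ℝ := fun i => if b i then 1 else -1

/-- The measure `δ_J = 2^{-n} ∑_{s ∈ 𝒮ⁿ} σ_J(s) δ_s`. -/
def deltaJ {n : ℕ} (J : Finset (Fin n)) : SM n :=
  ((2 : ℝ) ^ n)⁻¹ •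
    ∑ b : Fin n → Bool,
      (∏ j ∈ J, (if b j then (1 : ℝ) else -1)) • toSigned (Measure.dirac (signVec b))

/-- `𝒥(E; Fe, Fo)`. -/
def JsetE {n : ℕ} (E : Finset (Fin n)) (Fe Fo : Set (Finset (Fin n))) :
    Set (Finset (Fin n)) :=
  {J | J ⊆ E ∧ (∀ F ∈ Fe, Even (J ∩ F).card) ∧ (∀ F ∈ Fo, Odd (J ∩ F).card)}

/-- `𝒥(Fe, Fo) = 𝒥([n]; Fe, Fo)`. -/
def Jset {n : ℕ} (Fe Fo : Set (Finset (Fin n))) : Set (Finset (Fin n)) :=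
  {J | (∀ F ∈ Fe, Even (J ∩ F).card) ∧ (∀ F ∈ Fo, Odd (J ∩ F).card)}

/-- `G` has a representation `G = F₁ Δ … Δ F_m` with each `Fᵢ` drawn from `Fe` or `Fo`,
in which the number of terms drawn from `Fo` is even (`odd = false`) or odd (`odd = true`). -/
def HasRep {n : ℕ} (Fe Fo : Set (Finset (Fin n))) (G : Finset (Fin n)) (odd : Bool) : Prop :=
  ∃ l : List (Finset (Fin n) × Bool),
    (∀ p ∈ l, if p.2 then p.1 ∈ Fo else p.1 ∈ Fe) ∧
    (l.map Prod.fst).foldr (· ∆ ·) ∅ = G ∧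
    (l.countP (fun p => p.2)) % 2 = (if odd then 1 else 0)

/-- The generating pair `(Fe, Fo)` is proper: the even and odd parts of the generated group
are disjoint. -/
def ProperPair {n : ℕ} (Fe Fo : Set (Finset (Fin n))) : Prop :=
  ∀ G : Finset (Fin n), ¬ (HasRep Fe Fo G false ∧ HasRep Fe Fo G true)

/-- `ℳ^int(A; Fe, Fo)`: integrable signed measures concentrated on `A`, even under `T_F`
for `F ∈ Fe` and odd under `T_F` for `F ∈ Fo`. -/
def MclassInt {n : ℕ} (A : Set (Fin n → ℝ)) (Fe Fo : Set (Finset (Fin n))) : Set (SM n) :=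
  {μ | IntegrableSM μ ∧ ConcOn μ A ∧ (∀ F ∈ Fe, EvenUnder μ F) ∧ (∀ F ∈ Fo, OddUnder μ F)}

/-- `ν` is universal on `𝒜`. -/
def Universal {n : ℕ} (ν : SM n) (𝒜 : Set (SM n)) : Prop :=
  ∀ μ ∈ 𝒜, mconv ν μ = 0 → μ = 0

/-- Radial projection of a non-negative measure. -/
def radPos {n : ℕ} (ρ : Measure (Fin n → ℝ)) : Measure (Fin n → ℝ) :=
  (ρ.withDensity fun x => ENNReal.ofReal (e2 x)).map (fun x => (e2 x)⁻¹ • x)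

/-- Radial projection `P_S` of a signed measure. -/
def PS {n : ℕ} (μ : SM n) : SM n :=
  toSigned (radPos μ.toJordanDecomposition.posPart) -
    toSigned (radPos μ.toJordanDecomposition.negPart)

/-- The spherical product `μ ⊛_S ν = P_S(μ ⊛ ν)`. -/
def mconvS {n : ℕ} (μ ν : SM n) : SM n := PS (mconv μ ν)

/-- `ν` is spherically universal on `𝒜`. -/
def SphUniversal {n : ℕ} (ν : SM n) (𝒜 : Set (SM n)) : Prop :=
  ∀ μ ∈ 𝒜, mconvS ν μ = 0 → μ = 0

/-- The unconditional symmetrisation `M_unc`. -/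
def Munc {n : ℕ} (μ : SM n) : SM n := ((2 : ℝ) ^ n)⁻¹ • ∑ E : Finset (Fin n), Tmap E μ

/-- Integral of `f` against a signed measure. -/
def sInt {n : ℕ} (μ : SM n) (f : (Fin n → ℝ) → ℝ) : ℝ :=
  (∫ x, f x ∂μ.toJordanDecomposition.posPart) - ∫ x, f x ∂μ.toJordanDecomposition.negPart

/-- `δ₁ ⊗ μ`: the lifting of `μ` to a measure on `ℝ^{n+1}`, with an extra `0`-th coordinate
carrying a unit atom at `1`. -/
def lift0 {n : ℕ} (μ : SM n) : SM (n + 1) := μ.map (fun x => Fin.cons 1 x)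

/-- Symmetrisation about the origin. -/
def Msym {n : ℕ} (μ : SM n) : SM n := (2 : ℝ)⁻¹ • (μ + μ.map (fun x => -x))

/-- The lifting `L(μ) = P_S(M_sym(δ₁ ⊗ μ))`. -/
def Lift {n : ℕ} (μ : SM n) : SM (n + 1) := PS (Msym (lift0 μ))


open ProbabilityTheory Set in
/-- Finite measures on a Banach space are determined by the moment generating functions of
their one-dimensional marginals near the origin. -/
theorem ext_of_lintegral_exp_eq {V : Type*} [NormedAddCommGroup V] [NormedSpace ℝ V]
    [CompleteSpace V] [SecondCountableTopology V] [MeasurableSpace V] [BorelSpace V]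
    (ρ σ : Measure V) [IsFiniteMeasure ρ] [IsFiniteMeasure σ]
    (h : ∀ L : StrongDual ℝ V, ∃ ε > 0, ∀ s : ℝ, |s| < ε →
      ∫⁻ v, ENNReal.ofReal (Real.exp (s * L v)) ∂ρ = ∫⁻ v, ENNReal.ofReal (Real.exp (s * L v)) ∂σ ∧
      ∫⁻ v, ENNReal.ofReal (Real.exp (s * L v)) ∂ρ ≠ ⊤) : ρ = σ := by
  refine Measure.ext_of_charFunDual (funext fun L => ?_)
  obtain ⟨ε, hε, hL⟩ := h L
  have hint (τ : Measure V) (s : ℝ)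
      (hs : ∫⁻ v, ENNReal.ofReal (Real.exp (s * L v)) ∂τ ≠ ⊤) : s ∈ integrableExpSet L τ := by
    refine ⟨by fun_prop, ?_⟩
    rw [hasFiniteIntegral_iff_ofReal (.of_forall fun v => (Real.exp_pos _).le)]
    exact hs.lt_top
  have hball : Metric.ball (0 : ℝ) ε ⊆ integrableExpSet L ρ ∩ integrableExpSet L σ := by
    intro s hs
    rw [mem_ball_zero_iff, Real.norm_eq_abs] at hs
    exact ⟨hint ρ s (hL s hs).2, hint σ s ((hL s hs).1 ▸ (hL s hs).2)⟩
  have h0 : (0 : ℝ) ∈ interior (integrableExpSet L ρ) ∩ interior (integrableExpSet L σ) := by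
    rw [← interior_inter]
    exact interior_maximal hball Metric.isOpen_ball (Metric.mem_ball_self hε)
  have hev : ∀ s : ℝ, |s| < ε → complexMGF L ρ s = complexMGF L σ s := by
    intro s hs
    rw [complexMGF_ofReal, complexMGF_ofReal, mgf, mgf,
      integral_eq_lintegral_of_nonneg_ae (.of_forall fun v => (Real.exp_pos _).le) (by fun_prop),
      integral_eq_lintegral_of_nonneg_ae (.of_forall fun v => (Real.exp_pos _).le) (by fun_prop),
      (hL s hs).1]
  have hfreq : ∃ᶠ z : ℂ in nhdsWithin 0 {0}ᶜ, complexMGF L ρ z = complexMGF L σ z := by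
    have ht : Filter.Tendsto (fun s : ℝ => (s : ℂ)) (nhdsWithin 0 {0}ᶜ) (nhdsWithin 0 {0}ᶜ) := by
      refine tendsto_nhdsWithin_iff.2 ⟨?_, ?_⟩
      · exact (Complex.continuous_ofReal.tendsto' 0 0 (by simp)).mono_left nhdsWithin_le_nhds
      · filter_upwards [self_mem_nhdsWithin] with s hs
        simpa using hs
    refine ht.frequently (Filter.Eventually.frequently ?_)
    filter_upwards [nhdsWithin_le_nhds (Metric.ball_mem_nhds (0 : ℝ) hε)] with s hs
    exact hev s (by simpa using hs)
  have heq := AnalyticOnNhd.eqOn_of_preconnected_of_frequently_eq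
    (U := {z : ℂ | z.re ∈ interior (integrableExpSet L ρ) ∩ interior (integrableExpSet L σ)})
    (z₀ := 0)
    ((analyticOnNhd_complexMGF (X := L) (μ := ρ)).mono fun z hz => hz.1)
    ((analyticOnNhd_complexMGF (X := L) (μ := σ)).mono fun z hz => hz.2)
    ((convex_integrableExpSet.interior.inter convex_integrableExpSet.interior).linear_preimage
      Complex.reLm).isPreconnected (by simpa using h0) hfreq
  have hI := heq (x := Complex.I) (by simpa using h0)
  simpa only [charFunDual_apply, complexMGF, mul_comm] using hI

/-- The generalized monomial `∏_{i ∈ E} |xᵢ|^{aᵢ}`. -/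
def absMonomial {n : ℕ} (E : Finset (Fin n)) (a x : Fin n → ℝ) : ℝ≥0∞ :=
  ∏ i ∈ E, ENNReal.ofReal (|x i| ^ a i)

@[fun_prop]
theorem measurable_absMonomial {n : ℕ} (E : Finset (Fin n)) (a : Fin n → ℝ) :
    Measurable (absMonomial E a) := by
  unfold absMonomial
  fun_prop

theorem absMonomial_mul {n : ℕ} (E : Finset (Fin n)) (a x y : Fin n → ℝ) :
    absMonomial E a (x * y) = absMonomial E a x * absMonomial E a y := by
  simp only [absMonomial, ← Finset.prod_mul_distrib]
  refine Finset.prod_congr rfl fun i _ => ?_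
  rw [← ENNReal.ofReal_mul (by positivity), Pi.mul_apply, abs_mul,
    Real.mul_rpow (abs_nonneg _) (abs_nonneg _)]

theorem measurable_e2 {n : ℕ} : Measurable (e2 : (Fin n → ℝ) → ℝ) := by
  unfold e2
  fun_prop

theorem abs_le_e2 {n : ℕ} (x : Fin n → ℝ) (i : Fin n) : |x i| ≤ e2 x := by
  refine Real.le_sqrt_of_sq_le ?_
  rw [sq_abs]
  exact Finset.single_le_sum (f := fun i => x i ^ 2) (fun _ _ => sq_nonneg _) (Finset.mem_univ i)

theorem e2_nonneg {n : ℕ} (x : Fin n → ℝ) : 0 ≤ e2 x := Real.sqrt_nonneg _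

theorem absMonomial_le {n : ℕ} (E : Finset (Fin n)) (a x : Fin n → ℝ) (ha : ∀ i, 0 < a i)
    (ha' : ∀ i, a i * n ≤ 1) : absMonomial E a x ≤ 1 + ENNReal.ofReal (e2 x) := by
  have he := e2_nonneg x
  rw [absMonomial, ← ENNReal.ofReal_prod_of_nonneg (fun _ _ => by positivity),
    ← ENNReal.ofReal_one, ← ENNReal.ofReal_add zero_le_one he]
  refine ENNReal.ofReal_le_ofReal ?_
  calc ∏ i ∈ E, |x i| ^ a i ≤ ∏ _i ∈ E, (1 + e2 x) ^ (1 / n : ℝ) := by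
        refine Finset.prod_le_prod (fun _ _ => by positivity) fun i _ => ?_
        have hn : (0 : ℝ) < n := by exact_mod_cast i.pos
        calc |x i| ^ a i ≤ (1 + e2 x) ^ a i :=
              Real.rpow_le_rpow (abs_nonneg _) (by linarith [abs_le_e2 x i]) (ha i).le
          _ ≤ (1 + e2 x) ^ (1 / n : ℝ) :=
              Real.rpow_le_rpow_of_exponent_le (by linarith) ((le_div_iff₀ hn).2 (ha' i))
    _ = (1 + e2 x) ^ ((1 / n : ℝ) * E.card) := by
        rw [Finset.prod_const, ← Real.rpow_natCast, ← Real.rpow_mul (by linarith)]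
    _ ≤ (1 + e2 x) ^ (1 : ℝ) := by
        refine Real.rpow_le_rpow_of_exponent_le (by linarith) ?_
        have hc : (E.card : ℝ) ≤ n := by exact_mod_cast card_finset_fin_le E
        rw [one_div_mul_eq_div]
        exact div_le_one_of_le₀ hc (Nat.cast_nonneg n)
    _ = 1 + e2 x := Real.rpow_one _

theorem lintegral_absMonomial_ne_top {n : ℕ} (p : Measure (Fin n → ℝ)) [IsFiniteMeasure p]
    (hp : ∫⁻ x, ENNReal.ofReal (e2 x) ∂p ≠ ⊤) (E : Finset (Fin n)) (a : Fin n → ℝ)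
    (ha : ∀ i, 0 < a i) (ha' : ∀ i, a i * n ≤ 1) : ∫⁻ x, absMonomial E a x ∂p ≠ ⊤ := by
  refine ne_top_of_le_ne_top ?_ (lintegral_mono fun x => absMonomial_le E a x ha ha')
  rw [lintegral_add_left measurable_const]
  simpa using hp

/-- The coordinatewise logarithm on the coordinates in `E`. -/
def logE {n : ℕ} (E : Finset (Fin n)) (x : Fin n → ℝ) : Fin n → ℝ :=
  fun i => if i ∈ E then Real.log (x i) else 0

@[fun_prop]
theorem measurable_logE {n : ℕ} (E : Finset (Fin n)) : Measurable (logE E) := by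
  refine measurable_pi_lambda _ fun i => ?_
  unfold logE
  split_ifs <;> fun_prop

theorem absMonomial_mul_exp {n : ℕ} (E : Finset (Fin n)) (a b x : Fin n → ℝ) (ha : ∀ i, 0 < a i)
    (hab : ∀ i, 0 < a i + b i) :
    absMonomial E a x * ENNReal.ofReal (Real.exp (∑ i, logE E x i * b i)) =
      absMonomial E (a + b) x := by
  have h1 : ∑ i, logE E x i * b i = ∑ i ∈ E, Real.log (x i) * b i := by
    simp [logE, ite_mul, Finset.sum_ite_mem]
  rw [h1, Real.exp_sum, ENNReal.ofReal_prod_of_nonneg (fun _ _ => (Real.exp_pos _).le),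
    absMonomial, absMonomial, ← Finset.prod_mul_distrib]
  refine Finset.prod_congr rfl fun i _ => ?_
  rw [← ENNReal.ofReal_mul (by positivity)]
  congr 1
  rcases eq_or_ne (x i) 0 with h | h
  · simp [h, Real.zero_rpow (ha i).ne', Real.zero_rpow (hab i).ne']
  · rw [Pi.add_apply, Real.rpow_add (abs_pos.2 h), Real.rpow_def_of_pos (abs_pos.2 h) (b i),
      Real.log_abs]

theorem map_logE_eq {n : ℕ} (p q : Measure (Fin n → ℝ)) [IsFiniteMeasure p] [IsFiniteMeasure q]
    (hp : ∫⁻ x, ENNReal.ofReal (e2 x) ∂p ≠ ⊤) (hq : ∫⁻ x, ENNReal.ofReal (e2 x) ∂q ≠ ⊤)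
    (E : Finset (Fin n))
    (h : ∀ a : Fin n → ℝ, (∀ i, 0 < a i) → (∀ i, a i * n ≤ 1) →
      ∫⁻ x, absMonomial E a x ∂p = ∫⁻ x, absMonomial E a x ∂q)
    (c : ℝ) (hc : 0 < c) (hc' : 2 * c * n ≤ 1) :
    (p.withDensity (absMonomial E fun _ => c)).map (logE E) =
      (q.withDensity (absMonomial E fun _ => c)).map (logE E) := by
  have hcn : c * n ≤ 1 := le_trans (by nlinarith [Nat.cast_nonneg (α := ℝ) n]) hc'
  have := isFiniteMeasure_withDensity
    (lintegral_absMonomial_ne_top p hp E (fun _ => c) (fun _ => hc) (fun _ => hcn))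
  have := isFiniteMeasure_withDensity
    (lintegral_absMonomial_ne_top q hq E (fun _ => c) (fun _ => hc) (fun _ => hcn))
  refine ext_of_lintegral_exp_eq _ _ fun L => ⟨c / (‖L‖ + 1), by positivity, fun s hs => ?_⟩
  set b : Fin n → ℝ := fun i => s * L (Pi.single i 1) with hb
  have hbc (i : Fin n) : |b i| < c := by
    have h1 : |L (Pi.single i 1)| ≤ ‖L‖ := by
      simpa [Pi.norm_single] using L.le_opNorm (Pi.single i (1 : ℝ))
    rw [lt_div_iff₀ (by positivity)] at hs
    rw [hb, abs_mul]
    nlinarith [abs_nonneg s]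
  have hpos (i : Fin n) : 0 < c + b i := by linarith [neg_abs_le (b i), hbc i]
  have hle (i : Fin n) : (c + b i) * n ≤ 1 := by
    refine le_trans (mul_le_mul_of_nonneg_right ?_ (Nat.cast_nonneg n)) hc'
    linarith [le_abs_self (b i), hbc i]
  have key (r : Measure (Fin n → ℝ)) :
      ∫⁻ v, ENNReal.ofReal (Real.exp (s * L v))
        ∂(r.withDensity (absMonomial E fun _ => c)).map (logE E) =
      ∫⁻ x, absMonomial E ((fun _ => c) + b) x ∂r := by
    rw [lintegral_map (by fun_prop) (by fun_prop),
      lintegral_withDensity_eq_lintegral_mul _ (by fun_prop) (by fun_prop)]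
    refine lintegral_congr fun x => ?_
    rw [Pi.mul_apply, ← absMonomial_mul_exp E _ b x (fun _ => hc) hpos]
    congr 3
    conv_lhs => rw [← (LinearMap.sum_single_apply (fun _ : Fin n => ℝ) (logE E x))]
    rw [map_sum, Finset.mul_sum]
    refine Finset.sum_congr rfl fun i _ => ?_
    have : Pi.single i (logE E x i) = logE E x i • (Pi.single i (1 : ℝ) : Fin n → ℝ) := by
      rw [← Pi.single_smul, smul_eq_mul, mul_one]
    rw [this, map_smul, smul_eq_mul, hb]
    ring
  rw [key, key]
  exact ⟨h _ hpos hle, lintegral_absMonomial_ne_top p hp E _ hpos hle⟩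

open Set in
/-- Finite measures agreeing on all boxes whose sides are everything or avoid `0` are equal. -/
theorem ext_of_boxes {n : ℕ} (p q : Measure (Fin n → ℝ)) [IsFiniteMeasure p] [IsFiniteMeasure q]
    (h : ∀ B : Fin n → Set ℝ, (∀ i, MeasurableSet (B i)) → (∀ i, (0 : ℝ) ∉ B i ∨ B i = univ) →
      p (univ.pi B) = q (univ.pi B)) : p = q := by
  let C : Set (Set ℝ) := {B | MeasurableSet B ∧ ((0 : ℝ) ∉ B ∨ B = univ)}
  have hC : IsPiSystem C := by
    rintro s ⟨hs, hs'⟩ t ⟨ht, ht'⟩ -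
    refine ⟨hs.inter ht, ?_⟩
    rcases hs' with hs' | rfl
    · exact .inl fun h0 => hs' h0.1
    · simpa using ht'
  have hgen : MeasurableSpace.generateFrom C = borel ℝ := by
    rw [← BorelSpace.measurable_eq (α := ℝ)]
    refine le_antisymm (MeasurableSpace.generateFrom_le fun s hs => hs.1) fun s hs => ?_
    by_cases h0 : (0 : ℝ) ∈ s
    · rw [← compl_compl s]
      exact (MeasurableSpace.measurableSet_generateFrom
        (show sᶜ ∈ C from ⟨hs.compl, .inl fun h => h h0⟩)).compl
    · exact MeasurableSpace.measurableSet_generateFrom ⟨hs, .inl h0⟩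
  have hspan : IsCountablySpanning C :=
    ⟨fun _ => univ, fun _ => ⟨.univ, .inr rfl⟩, iUnion_const _⟩
  refine ext_of_generate_finite (univ.pi '' univ.pi fun _ => C) ?_
    (IsPiSystem.pi fun _ => hC) ?_ ?_
  · refine (generateFrom_eq_pi (fun _ => ?_) fun _ => hspan).symm
    rw [hgen, BorelSpace.measurable_eq (α := ℝ)]
  · rintro _ ⟨B, hB, rfl⟩
    exact h B (fun i => (hB i trivial).1) fun i => (hB i trivial).2
  · simpa using h (fun _ => univ) (fun _ => .univ) fun _ => .inr rfl

open Set in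
theorem map_abs_eq_of_lintegral_absMonomial_eq {n : ℕ} (hn : 1 ≤ n) (p q : Measure (Fin n → ℝ))
    [IsFiniteMeasure p] [IsFiniteMeasure q]
    (hp : ∫⁻ x, ENNReal.ofReal (e2 x) ∂p ≠ ⊤) (hq : ∫⁻ x, ENNReal.ofReal (e2 x) ∂q ≠ ⊤)
    (h : ∀ (E : Finset (Fin n)) (a : Fin n → ℝ), (∀ i, 0 < a i) → (∀ i, a i * n ≤ 1) →
      ∫⁻ x, absMonomial E a x ∂p = ∫⁻ x, absMonomial E a x ∂q) :
    p.map (fun x i => |x i|) = q.map (fun x i => |x i|) := by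
  have habs : Measurable fun (x : Fin n → ℝ) i => |x i| := by fun_prop
  have hn' : (0 : ℝ) < n := by exact_mod_cast hn
  set c : ℝ := 1 / (2 * n) with hcdef
  have hc : 0 < c := by positivity
  have hc' : 2 * c * n ≤ 1 := by rw [hcdef]; field_simp; rfl
  refine ext_of_boxes _ _ fun B hB hB0 => ?_
  let E : Finset (Fin n) := Finset.univ.filter fun i => B i ≠ univ
  let f : (Fin n → ℝ) → ℝ≥0∞ := fun y => ∏ i ∈ E,
    (ENNReal.ofReal (Real.exp (-c * y i)) * (B i).indicator 1 (Real.exp (y i)))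
  have hf : Measurable f := by
    refine Finset.measurable_prod _ fun i _ => ?_
    refine Measurable.mul (by fun_prop) ?_
    exact (measurable_one.indicator (hB i)).comp (by fun_prop)
  have key (r : Measure (Fin n → ℝ)) : (r.map fun x i => |x i|) (univ.pi B) =
      ∫⁻ y, f y ∂(r.withDensity (absMonomial E fun _ => c)).map (logE E) := by
    have hBm : MeasurableSet (univ.pi B) := .univ_pi hB
    rw [lintegral_map hf (by fun_prop),
      lintegral_withDensity_eq_lintegral_mul _ (by fun_prop)
        (g := fun x => f (logE E x)) (hf.comp (by fun_prop)),
      Measure.map_apply habs hBm, ← lintegral_indicator_one (habs hBm)]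
    refine lintegral_congr fun x => ?_
    have hfac : ∀ i ∈ E, ENNReal.ofReal (|x i| ^ c) *
        (ENNReal.ofReal (Real.exp (-c * logE E x i)) *
          (B i).indicator 1 (Real.exp (logE E x i))) = (B i).indicator 1 |x i| := by
      intro i hi
      have h0 : (0 : ℝ) ∉ B i := (hB0 i).resolve_right (Finset.mem_filter.1 hi).2
      simp only [logE, if_pos hi]
      rcases eq_or_ne (x i) 0 with hx | hx
      · simp [hx, Real.zero_rpow hc.ne', h0]
      · rw [Real.exp_log_eq_abs hx, ← mul_assoc, ← ENNReal.ofReal_mul (by positivity),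
          Real.rpow_def_of_pos (abs_pos.2 hx), Real.log_abs, ← Real.exp_add]
        simp [mul_comm c]
    rw [Pi.mul_apply, absMonomial, ← Finset.prod_mul_distrib,
      Finset.prod_congr rfl hfac]
    by_cases hx : ∀ i, |x i| ∈ B i
    · rw [indicator_of_mem (by simpa using hx),
        Finset.prod_eq_one fun i _ => by simp [hx i], Pi.one_apply]
    · obtain ⟨i, hi⟩ := not_forall.1 hx
      rw [indicator_of_notMem (by simpa using hx), Finset.prod_eq_zero (i := i)]
      · exact Finset.mem_filter.2 ⟨Finset.mem_univ i, fun h => hi (h ▸ trivial)⟩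
      · simp [hi]
  rw [key, key, map_logE_eq p q hp hq E (h E) c hc hc']

theorem toSigned_eq {X : Type*} [MeasurableSpace X] (ρ : Measure X) [h : IsFiniteMeasure ρ] :
    toSigned ρ = ρ.toSignedMeasure := dif_pos h

instance {n : ℕ} (ρ σ : Measure (Fin n → ℝ)) [IsFiniteMeasure ρ] [IsFiniteMeasure σ] :
    IsFiniteMeasure (mconvPos ρ σ) := by
  unfold mconvPos
  infer_instance

theorem lintegral_mconvPos {n : ℕ} (ρ σ : Measure (Fin n → ℝ)) [IsFiniteMeasure ρ]
    [IsFiniteMeasure σ] (f : (Fin n → ℝ) → ℝ≥0∞) (hf : Measurable f) :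
    ∫⁻ z, f z ∂mconvPos ρ σ = ∫⁻ x, ∫⁻ y, f (x * y) ∂σ ∂ρ := by
  rw [mconvPos, lintegral_map hf (by fun_prop), lintegral_prod _ (by fun_prop)]

theorem mconvPos_add {n : ℕ} (ρ σ τ : Measure (Fin n → ℝ)) [IsFiniteMeasure ρ]
    [IsFiniteMeasure σ] [IsFiniteMeasure τ] :
    mconvPos ρ (σ + τ) = mconvPos ρ σ + mconvPos ρ τ := by
  rw [mconvPos, Measure.prod_add, Measure.map_add _ _ (by fun_prop)]
  rfl

theorem negPart_eq_zero_of_nonneg {X : Type*} [MeasurableSpace X] {ν : SignedMeasure X}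
    (h : 0 ≤ ν) : ν.toJordanDecomposition.negPart = 0 := by
  have h' := (VectorMeasure.le_restrict_univ_iff_le _ _).2 h
  let j : JordanDecomposition X :=
    { posPart := ν.toMeasureOfZeroLE Set.univ .univ h'
      negPart := 0
      posPart_finite := inferInstance
      negPart_finite := inferInstance
      mutuallySingular := Measure.MutuallySingular.zero_right }
  have : ν.toJordanDecomposition = j := by
    refine SignedMeasure.toJordanDecomposition_eq ?_
    simp only [JordanDecomposition.toSignedMeasure, j, Measure.toSignedMeasure_zero, sub_zero]
    exact (SignedMeasure.toMeasureOfZeroLE_toSignedMeasure _ h').symm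
  rw [this]

theorem mconv_eq_zero_iff {n : ℕ} {ν : SM n} (hpos : 0 ≤ ν) (μ : SM n) :
    mconv ν μ = 0 ↔
      mconvPos ν.toJordanDecomposition.posPart μ.toJordanDecomposition.posPart =
        mconvPos ν.toJordanDecomposition.posPart μ.toJordanDecomposition.negPart := by
  have h0 (σ : Measure (Fin n → ℝ)) : mconvPos 0 σ = 0 := by simp [mconvPos]
  rw [mconv, negPart_eq_zero_of_nonneg hpos, h0, h0, add_zero, add_zero, toSigned_eq, toSigned_eq,
    sub_eq_zero, Measure.toSignedMeasure_eq_toSignedMeasure_iff]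

theorem lintegral_posPart_negPart_ne_top {n : ℕ} {μ : SM n} (h : IntegrableSM μ) :
    ∫⁻ x, ENNReal.ofReal (e2 x) ∂μ.toJordanDecomposition.posPart ≠ ⊤ ∧
      ∫⁻ x, ENNReal.ofReal (e2 x) ∂μ.toJordanDecomposition.negPart ≠ ⊤ := by
  rw [IntegrableSM, SignedMeasure.totalVariation, lintegral_add_measure, ENNReal.add_lt_top] at h
  exact ⟨h.1.ne, h.2.ne⟩

theorem measurable_flipE {n : ℕ} (E : Finset (Fin n)) : Measurable (flipE E) := by
  refine measurable_pi_lambda _ fun i => ?_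
  unfold flipE
  split_ifs <;> fun_prop

theorem flipE_flipE {n : ℕ} (E F : Finset (Fin n)) (x : Fin n → ℝ) :
    flipE E (flipE F x) = flipE (F ∆ E) x := by
  ext i
  by_cases h1 : i ∈ E <;> by_cases h2 : i ∈ F <;> simp [flipE, Finset.mem_symmDiff, h1, h2]

theorem sum_flipE_flipE {n : ℕ} {M : Type*} [AddCommMonoid M] (g : (Fin n → ℝ) → M)
    (F : Finset (Fin n)) (x : Fin n → ℝ) :
    ∑ E : Finset (Fin n), g (flipE E (flipE F x)) = ∑ E : Finset (Fin n), g (flipE E x) := by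
  simp only [flipE_flipE]
  exact (symmDiff_right_involutive F).bijective.sum_comp fun E => g (flipE E x)

theorem abs_eq_flipE {n : ℕ} (x : Fin n → ℝ) :
    (fun i => |x i|) = flipE (Finset.univ.filter fun i => x i < 0) x := by
  ext i
  by_cases h : x i < 0
  · simp [flipE, h, abs_of_neg h]
  · simp [flipE, h, abs_of_nonneg (not_lt.1 h)]

/-- The symmetrisation over all reflections depends only on the law of the absolute values. -/
theorem sum_measure_flipE_preimage_eq {n : ℕ} {p q : Measure (Fin n → ℝ)}
    (h : p.map (fun x i => |x i|) = q.map (fun x i => |x i|)) {A : Set (Fin n → ℝ)}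
    (hA : MeasurableSet A) :
    ∑ E : Finset (Fin n), p (flipE E ⁻¹' A) = ∑ E : Finset (Fin n), q (flipE E ⁻¹' A) := by
  have hm (E : Finset (Fin n)) :
      Measurable fun x => A.indicator (1 : (Fin n → ℝ) → ℝ≥0∞) (flipE E x) :=
    (measurable_one.indicator hA).comp (measurable_flipE E)
  have key (r : Measure (Fin n → ℝ)) : ∑ E : Finset (Fin n), r (flipE E ⁻¹' A) =
      ∫⁻ x, ∑ E : Finset (Fin n), A.indicator (1 : (Fin n → ℝ) → ℝ≥0∞) (flipE E x)
        ∂r.map (fun x i => |x i|) := by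
    rw [lintegral_map (Finset.measurable_sum _ fun E _ => hm E) (by fun_prop)]
    simp_rw [abs_eq_flipE, sum_flipE_flipE]
    rw [lintegral_finsetSum _ fun E _ => hm E]
    refine Finset.sum_congr rfl fun E _ => ?_
    rw [← lintegral_indicator_one (measurable_flipE E hA)]
    rfl
  rw [key, key, h]

theorem eq_zero_of_map_abs_eq {n : ℕ} {μ : SM n} (hμ : ∀ E : Finset (Fin n), Tmap E μ = μ)
    (h : μ.toJordanDecomposition.posPart.map (fun x i => |x i|) =
      μ.toJordanDecomposition.negPart.map (fun x i => |x i|)) : μ = 0 := by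
  ext A hA
  have hE (E : Finset (Fin n)) : μ A = μ.toJordanDecomposition.posPart.real (flipE E ⁻¹' A) -
      μ.toJordanDecomposition.negPart.real (flipE E ⁻¹' A) := by
    rw [← SignedMeasure.apply_eq_posPart_real_sub_negPart_real μ (measurable_flipE E hA),
      ← VectorMeasure.map_apply _ (measurable_flipE E) hA]
    exact (congrArg (fun ξ : SM n => ξ A) (hμ E)).symm
  have hsum : ∑ _E : Finset (Fin n), μ A = 0 := by
    rw [Finset.sum_congr rfl fun E _ => hE E, Finset.sum_sub_distrib, sub_eq_zero]
    simp only [Measure.real]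
    rw [← ENNReal.toReal_sum fun _ _ => measure_ne_top _ _,
      ← ENNReal.toReal_sum fun _ _ => measure_ne_top _ _, sum_measure_flipE_preimage_eq h hA]
  simpa using hsum

theorem measurableSet_setA {n : ℕ} (E : Finset (Fin n)) : MeasurableSet (setA E) := by
  have : setA E = ⋂ i, {x : Fin n → ℝ | x i ≠ 0 ↔ i ∈ E} := by ext; simp [setA]
  rw [this]
  refine .iInter fun i => ?_
  have hm : MeasurableSet {x : Fin n → ℝ | x i = 0} :=
    measurableSet_eq_fun (by fun_prop) measurable_const
  by_cases hi : i ∈ E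
  · simp only [hi, iff_true]
    exact hm.compl
  · simpa [hi] using hm

theorem Rres_eq_zero_iff {n : ℕ} {ν : SM n} (hpos : 0 ≤ ν) (E : Finset (Fin n)) :
    Rres E ν = 0 ↔ ν.toJordanDecomposition.posPart (setA E) = 0 := by
  have hν : ν = ν.toJordanDecomposition.posPart.toSignedMeasure := by
    conv_lhs => rw [← ν.toSignedMeasure_toJordanDecomposition, JordanDecomposition.toSignedMeasure]
    simp [negPart_eq_zero_of_nonneg hpos, Measure.toSignedMeasure_zero]
  rw [Rres]
  conv_lhs => rw [hν]
  rw [VectorMeasure.restrict_toSignedMeasure (measurableSet_setA E), ← Measure.toSignedMeasure_zero,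
    Measure.toSignedMeasure_eq_toSignedMeasure_iff, Measure.restrict_eq_zero]

theorem universal_of_posPart_setA_univ_ne_zero {n : ℕ} (hn : 1 ≤ n) {ν : SM n}
    (hint : IntegrableSM ν) (hpos : 0 ≤ ν)
    (hν : ν.toJordanDecomposition.posPart (setA Finset.univ) ≠ 0) :
    Universal ν {μ : SM n | IntegrableSM μ ∧ ∀ E : Finset (Fin n), Tmap E μ = μ} := by
  rintro μ ⟨hμint, hμ⟩ h0
  rw [mconv_eq_zero_iff hpos] at h0
  obtain ⟨hp, hq⟩ := lintegral_posPart_negPart_ne_top hμint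
  refine eq_zero_of_map_abs_eq hμ (map_abs_eq_of_lintegral_absMonomial_eq hn _ _ hp hq ?_)
  intro E a ha ha'
  have hmul (r : Measure (Fin n → ℝ)) [IsFiniteMeasure r] :
      ∫⁻ z, absMonomial E a z ∂mconvPos ν.toJordanDecomposition.posPart r =
        (∫⁻ x, absMonomial E a x ∂ν.toJordanDecomposition.posPart) *
          ∫⁻ y, absMonomial E a y ∂r := by
    rw [lintegral_mconvPos _ _ _ (by fun_prop)]
    simp_rw [absMonomial_mul]
    rw [← lintegral_mul_const _ (by fun_prop)]
    exact lintegral_congr fun x => lintegral_const_mul _ (by fun_prop)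
  have hne : ∫⁻ x, absMonomial E a x ∂ν.toJordanDecomposition.posPart ≠ 0 := by
    rw [← pos_iff_ne_zero, lintegral_pos_iff_support (by fun_prop)]
    refine (pos_iff_ne_zero.2 hν).trans_le (measure_mono fun x hx => ?_)
    refine Finset.prod_ne_zero_iff.2 fun i _ => ?_
    have : 0 < |x i| := abs_pos.2 ((hx i).2 (Finset.mem_univ i))
    simpa using Real.rpow_pos_of_pos this _
  refine (ENNReal.mul_right_inj hne (lintegral_absMonomial_ne_top _
    (lintegral_posPart_negPart_ne_top hint).1 E a ha ha')).1 ?_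
  rw [← hmul, ← hmul, h0]

theorem add_eq_add_of_toSignedMeasure_sub_eq {X : Type*} [MeasurableSpace X] (P Q : Measure X)
    [IsFiniteMeasure P] [IsFiniteMeasure Q] :
    (P.toSignedMeasure - Q.toSignedMeasure).toJordanDecomposition.posPart + Q =
      P + (P.toSignedMeasure - Q.toSignedMeasure).toJordanDecomposition.negPart := by
  have h := (P.toSignedMeasure - Q.toSignedMeasure).toSignedMeasure_toJordanDecomposition
  rw [JordanDecomposition.toSignedMeasure, sub_eq_sub_iff_add_eq_add,
    ← Measure.toSignedMeasure_add, ← Measure.toSignedMeasure_add] at h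
  exact (Measure.toSignedMeasure_eq_toSignedMeasure_iff.1 h)

theorem posPart_toSignedMeasure_sub_le {X : Type*} [MeasurableSpace X] (P Q : Measure X)
    [IsFiniteMeasure P] [IsFiniteMeasure Q] :
    (P.toSignedMeasure - Q.toSignedMeasure).toJordanDecomposition.posPart ≤ P := by
  obtain ⟨i, hi, hi2, hi3, h, -⟩ :=
    (P.toSignedMeasure - Q.toSignedMeasure).toJordanDecomposition_spec
  rw [h]
  refine Measure.le_iff.2 fun A hA => ?_
  rw [SignedMeasure.toMeasureOfZeroLE_apply _ _ _ hA, ENNReal.coe_nnreal_eq, NNReal.coe_mk,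
    Measure.toSignedMeasure_sub_apply (hi.inter hA)]
  refine le_trans (ENNReal.ofReal_le_ofReal (sub_le_self _ measureReal_nonneg)) ?_
  rw [ofReal_measureReal]
  exact measure_mono Set.inter_subset_right

theorem integrableSM_toSignedMeasure_sub {n : ℕ} (P Q : Measure (Fin n → ℝ))
    [IsFiniteMeasure P] [IsFiniteMeasure Q]
    (hP : ∫⁻ x, ENNReal.ofReal (e2 x) ∂P ≠ ⊤) (hQ : ∫⁻ x, ENNReal.ofReal (e2 x) ∂Q ≠ ⊤) :
    IntegrableSM (P.toSignedMeasure - Q.toSignedMeasure) := by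
  rw [IntegrableSM, SignedMeasure.totalVariation, lintegral_add_measure, ENNReal.add_lt_top]
  refine ⟨(lintegral_mono' (posPart_toSignedMeasure_sub_le P Q) le_rfl).trans_lt hP.lt_top, ?_⟩
  rw [← JordanDecomposition.neg_posPart, ← SignedMeasure.toJordanDecomposition_neg, neg_sub]
  exact (lintegral_mono' (posPart_toSignedMeasure_sub_le Q P) le_rfl).trans_lt hQ.lt_top

theorem mconv_toSignedMeasure_sub_eq_zero {n : ℕ} {ν : SM n} (hpos : 0 ≤ ν)
    (P Q : Measure (Fin n → ℝ)) [IsFiniteMeasure P] [IsFiniteMeasure Q]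
    (h : mconvPos ν.toJordanDecomposition.posPart P =
      mconvPos ν.toJordanDecomposition.posPart Q) :
    mconv ν (P.toSignedMeasure - Q.toSignedMeasure) = 0 := by
  rw [mconv_eq_zero_iff hpos]
  have h2 := congrArg (mconvPos ν.toJordanDecomposition.posPart)
    (add_eq_add_of_toSignedMeasure_sub_eq P Q)
  rw [mconvPos_add, mconvPos_add, h, add_comm (mconvPos _ Q)] at h2
  refine Measure.ext fun A _ => ?_
  have h3 := congrArg (fun τ : Measure (Fin n → ℝ) => τ A) h2
  simp only [Measure.add_apply] at h3
  exact (ENNReal.add_left_inj (measure_ne_top _ _)).1 h3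

/-- The point obtained from `(1, …, 1)` by deleting the coordinates in `K` and reflecting those
in `F`. -/
def signPoint {n : ℕ} (F K : Finset (Fin n)) : Fin n → ℝ := flipE F (projE Kᶜ 1)

/-- The sum of the unit atoms at all reflections of the points `signPoint ∅ K`, `K ∈ S`. -/
def atomSum {n : ℕ} (S : Finset (Finset (Fin n))) : Measure (Fin n → ℝ) :=
  ∑ K ∈ S, ∑ F : Finset (Fin n), Measure.dirac (signPoint F K)

instance {n : ℕ} (S : Finset (Finset (Fin n))) : IsFiniteMeasure (atomSum S) := by
  unfold atomSum
  infer_instance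

theorem lintegral_atomSum {n : ℕ} (S : Finset (Finset (Fin n))) (f : (Fin n → ℝ) → ℝ≥0∞) :
    ∫⁻ x, f x ∂atomSum S = ∑ K ∈ S, ∑ F : Finset (Fin n), f (signPoint F K) := by
  simp [atomSum]

theorem atomSum_apply {n : ℕ} (S : Finset (Finset (Fin n))) {A : Set (Fin n → ℝ)}
    (hA : MeasurableSet A) :
    atomSum S A = ∑ K ∈ S, ∑ F : Finset (Fin n), A.indicator 1 (signPoint F K) := by
  rw [← lintegral_indicator_one hA, lintegral_atomSum]

theorem map_flipE_atomSum {n : ℕ} (S : Finset (Finset (Fin n))) (E : Finset (Fin n)) :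
    (atomSum S).map (flipE E) = atomSum S := by
  refine Measure.ext fun A hA => ?_
  rw [Measure.map_apply (measurable_flipE E) hA, atomSum_apply S (measurable_flipE E hA),
    atomSum_apply S hA]
  refine Finset.sum_congr rfl fun K _ => ?_
  have h (F : Finset (Fin n)) : (flipE E ⁻¹' A).indicator (1 : (Fin n → ℝ) → ℝ≥0∞) (signPoint F K) =
      A.indicator 1 (flipE F (flipE E (projE Kᶜ 1))) := by
    rw [flipE_flipE, symmDiff_comm, ← flipE_flipE]
    rfl
  simp_rw [h]
  exact sum_flipE_flipE (A.indicator (1 : (Fin n → ℝ) → ℝ≥0∞)) E (projE Kᶜ 1)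

theorem signPoint_mem_setA_univ {n : ℕ} (F K : Finset (Fin n)) :
    signPoint F K ∈ setA Finset.univ ↔ K = ∅ := by
  simp only [setA, Set.mem_ofPred_eq, Finset.mem_univ, iff_true, Finset.eq_empty_iff_forall_notMem]
  refine forall_congr' fun i => ?_
  by_cases h : i ∈ K <;> by_cases h' : i ∈ F <;> simp [signPoint, flipE, projE, h, h']

theorem even_card_symmDiff_singleton {n : ℕ} (K : Finset (Fin n)) (i : Fin n) :
    Even (K ∆ {i}).card ↔ ¬ Even K.card := by
  by_cases h : i ∈ K
  · have : K ∆ {i} = K.erase i := by ext j; simp [Finset.mem_symmDiff]; grind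
    rw [this, ← Finset.card_erase_add_one h, Nat.even_add_one, not_not]
  · have : K ∆ {i} = insert i K := by ext j; simp [Finset.mem_symmDiff]; grind
    rw [this, Finset.card_insert_of_notMem h, Nat.even_add_one]

theorem mul_signPoint_symmDiff {n : ℕ} (F K : Finset (Fin n)) {x : Fin n → ℝ} {i : Fin n}
    (hx : x i = 0) : x * signPoint F (K ∆ {i}) = x * signPoint F K := by
  ext j
  rcases eq_or_ne j i with rfl | h
  · simp [hx]
  · simp [signPoint, flipE, projE, h]

theorem mconvPos_atomSum_eq {n : ℕ} (N : Measure (Fin n → ℝ)) [IsFiniteMeasure N]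
    (hN : N (setA Finset.univ) = 0) :
    mconvPos N (atomSum {K | Even K.card}) = mconvPos N (atomSum {K | ¬ Even K.card}) := by
  refine Measure.ext fun A hA => ?_
  have hA' : Measurable (A.indicator (1 : (Fin n → ℝ) → ℝ≥0∞)) := measurable_one.indicator hA
  rw [← lintegral_indicator_one hA, ← lintegral_indicator_one hA, lintegral_mconvPos _ _ _ hA',
    lintegral_mconvPos _ _ _ hA']
  refine lintegral_congr_ae ?_
  filter_upwards [measure_eq_zero_iff_ae_notMem.1 hN] with x hx
  obtain ⟨i, hi⟩ : ∃ i, x i = 0 := by simpa [setA] using hx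
  rw [lintegral_atomSum, lintegral_atomSum]
  refine Finset.sum_nbij' (· ∆ {i}) (· ∆ {i}) ?_ ?_ ?_ ?_ ?_
  · intro K hK
    simpa [even_card_symmDiff_singleton, -Nat.not_even_iff_odd] using hK
  · intro K hK
    simpa [even_card_symmDiff_singleton] using hK
  · intro K _
    exact symmDiff_symmDiff_cancel_right _ _
  · intro K _
    exact symmDiff_symmDiff_cancel_right _ _
  · intro K _
    simp only [mul_signPoint_symmDiff _ _ hi]

theorem atomSum_setA_univ_ne {n : ℕ} :
    atomSum ({K | Even K.card} : Finset (Finset (Fin n))) (setA Finset.univ) ≠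
      atomSum ({K | ¬ Even K.card} : Finset (Finset (Fin n))) (setA Finset.univ) := by
  have hm := measurableSet_setA (Finset.univ : Finset (Fin n))
  have h0 : atomSum ({K | ¬ Even K.card} : Finset (Finset (Fin n))) (setA Finset.univ) = 0 := by
    rw [atomSum_apply _ hm]
    refine Finset.sum_eq_zero fun K hK => Finset.sum_eq_zero fun F _ => ?_
    rw [Set.indicator_of_notMem]
    rw [signPoint_mem_setA_univ]
    rintro rfl
    simp at hK
  rw [h0, atomSum_apply _ hm, Ne, Finset.sum_eq_zero_iff]
  intro h
  have := Finset.sum_eq_zero_iff.1 (h ∅ (by simp)) ∅ (Finset.mem_univ _)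
  rw [Set.indicator_of_mem ((signPoint_mem_setA_univ _ _).2 rfl)] at this
  simp at this

theorem Tmap_toSignedMeasure_sub {n : ℕ} {P Q : Measure (Fin n → ℝ)} [IsFiniteMeasure P]
    [IsFiniteMeasure Q] {E : Finset (Fin n)} (hP : P.map (flipE E) = P)
    (hQ : Q.map (flipE E) = Q) :
    Tmap E (P.toSignedMeasure - Q.toSignedMeasure) = P.toSignedMeasure - Q.toSignedMeasure := by
  have hm := measurable_flipE E
  ext A hA
  rw [Tmap, VectorMeasure.map_apply _ hm hA, Measure.toSignedMeasure_sub_apply (hm hA),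
    Measure.toSignedMeasure_sub_apply hA, ← map_measureReal_apply hm hA,
    ← map_measureReal_apply hm hA, hP, hQ]

theorem posPart_setA_univ_ne_zero_of_universal {n : ℕ} {ν : SM n} (hpos : 0 ≤ ν)
    (hU : Universal ν {μ : SM n | IntegrableSM μ ∧ ∀ E : Finset (Fin n), Tmap E μ = μ}) :
    ν.toJordanDecomposition.posPart (setA Finset.univ) ≠ 0 := by
  intro hN
  have hfin (S : Finset (Finset (Fin n))) : ∫⁻ x, ENNReal.ofReal (e2 x) ∂atomSum S ≠ ⊤ := by
    rw [lintegral_atomSum]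
    exact ENNReal.sum_ne_top.2 fun _ _ => ENNReal.sum_ne_top.2 fun _ _ => ENNReal.ofReal_ne_top
  have h := hU ((atomSum {K | Even K.card}).toSignedMeasure -
      (atomSum {K | ¬ Even K.card}).toSignedMeasure)
    ⟨integrableSM_toSignedMeasure_sub _ _ (hfin _) (hfin _),
      fun E => Tmap_toSignedMeasure_sub (map_flipE_atomSum _ E) (map_flipE_atomSum _ E)⟩
    (mconv_toSignedMeasure_sub_eq_zero hpos _ _ (mconvPos_atomSum_eq _ hN))
  rw [sub_eq_zero, Measure.toSignedMeasure_eq_toSignedMeasure_iff] at h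
  exact atomSum_setA_univ_ne (by rw [h])

/-- Theorem: a non-negative integrable `ν` is universal on the integrable unconditional
measures on `ℝⁿ` iff it has degree `n`, i.e. `ν_{[n]} ≠ 0`. -/
theorem stmt3 {n : ℕ} (hn : 1 ≤ n) (ν : SM n) (hint : IntegrableSM ν) (hpos : 0 ≤ ν) :
    Universal ν {μ : SM n | IntegrableSM μ ∧ ∀ E : Finset (Fin n), Tmap E μ = μ} ↔
      Rres (Finset.univ : Finset (Fin n)) ν ≠ 0 := by
  rw [Ne, Rres_eq_zero_iff hpos]
  exact ⟨posPart_setA_univ_ne_zero_of_universal hpos,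
    universal_of_posPart_setA_univ_ne_zero hn hint hpos⟩

end
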